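/- For all nonnegative integers n, r and every integer m > 1, v_{mn+r} = (a^{1−ζ(mn+r)} / (ab)^{⌊(mn+r)/2⌋}) · Σ_{i=0}^{n} C(n,i)·c^{n−i}·u_m^{i}·u_{m−1}^{n−i}·v_{i+r}·δ[m,n,r,i], where δ[m,n,r,i] := (ab)^{⌊(i+r)/2⌋ + n·⌊m/2⌋} · a^{−ζ(m+1)·i − 1 + ζ(i+r)} · b^{ζ(m)·(n−i)}, powers with possibly negative integer exponents being taken in the sense of integer powers of nonzero real numbers. -/

import Mathlib

theorem aux_binom (A B : ℝ) (V : ℕ → ℝ) (m : ℕ)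
    (h : ∀ k, V (m + k) = A * V (k + 1) + B * V k) (n : ℕ) :
    ∀ r, V (m * n + r) =
      ∑ i ∈ Finset.range (n + 1), (n.choose i : ℝ) * (A ^ i * B ^ (n - i) * V (i + r)) := by
  induction n with
  | zero => intro r; simp
  | succ n ih =>
    intro r
    have e : m * (n + 1) + r = m * n + (m + r) := by ring
    rw [e, ih, Finset.sum_choose_succ_mul (fun i j => A ^ i * B ^ j * V (i + r)) n,
      ← Finset.sum_add_distrib]
    refine Finset.sum_congr rfl fun i hi => ?_
    have hi' : i ≤ n := by simpa [Nat.lt_succ_iff] using hi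
    have e1 : i + (m + r) = m + (i + r) := by ring
    have e2 : n + 1 - i = (n - i) + 1 := by omega
    have e3 : i + 1 + r = i + r + 1 := by ring
    rw [e1, h, e2]
    simp only [e3]
    ring

theorem aux_scale (a b c : ℝ) (v : ℕ → ℝ)
    (hv : ∀ n : ℕ, 2 ≤ n → v n = (if Even n then a else b) * v (n - 1) + c * v (n - 2)) (k : ℕ) :
    a ^ ((k + 2) % 2) * (a * b) ^ ((k + 2) / 2) * v (k + 2) =
      (a * b) * (a ^ ((k + 1) % 2) * (a * b) ^ ((k + 1) / 2) * v (k + 1)) +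
      (a * b * c) * (a ^ (k % 2) * (a * b) ^ (k / 2) * v k) := by
  have h := hv (k + 2) (by omega)
  have s1 : k + 2 - 1 = k + 1 := by omega
  have s2 : k + 2 - 2 = k := by omega
  rw [s1, s2] at h
  rw [h]
  rcases Nat.even_or_odd' k with ⟨j, rfl | rfl⟩
  · have t1 : (2 * j + 2) % 2 = 0 := by omega
    have t2 : (2 * j + 2) / 2 = j + 1 := by omega
    have t3 : (2 * j + 1) % 2 = 1 := by omega
    have t4 : (2 * j + 1) / 2 = j := by omega
    have t5 : (2 * j) % 2 = 0 := by omega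
    have t6 : (2 * j) / 2 = j := by omega
    rw [if_pos (Nat.even_iff.2 t1), t1, t2, t3, t4, t5, t6]
    ring
  · have t1 : (2 * j + 1 + 2) % 2 = 1 := by omega
    have t2 : (2 * j + 1 + 2) / 2 = j + 1 := by omega
    have t3 : (2 * j + 1 + 1) % 2 = 0 := by omega
    have t4 : (2 * j + 1 + 1) / 2 = j + 1 := by omega
    have t5 : (2 * j + 1) % 2 = 1 := by omega
    have t6 : (2 * j + 1) / 2 = j := by omega
    rw [if_neg (by rw [Nat.even_iff]; omega), t1, t2, t3, t4, t5, t6]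
    ring

theorem aux_add (p q a : ℝ) (U V : ℕ → ℝ) (hU0 : U 0 = 0) (hU1 : U 1 = a)
    (hU : ∀ k, U (k + 2) = p * U (k + 1) + q * U k)
    (hV : ∀ k, V (k + 2) = p * V (k + 1) + q * V k) (l : ℕ) :
    ∀ k, a * V (l + 1 + k) = U (l + 1) * V (k + 1) + q * U l * V k := by
  induction l with
  | zero => intro k; simp [hU0, hU1, add_comm]
  | succ l ih =>
    intro k
    have e : l + 1 + 1 + k = l + 1 + (k + 1) := by ring
    rw [e, ih, hV, hU]
    ring

theorem stmt_14 (a b c : ℝ) (ha : a ≠ 0) (hb : b ≠ 0) (hc : c ≠ 0)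
    (u : ℕ → ℝ) (hu0 : u 0 = 0) (hu1 : u 1 = 1)
    (hu : ∀ n : ℕ, 2 ≤ n → u n = (if Even n then a else b) * u (n - 1) + c * u (n - 2))
    (v : ℕ → ℝ) (hv0 : v 0 = 2) (hv1 : v 1 = b)
    (hv : ∀ n : ℕ, 2 ≤ n → v n = (if Even n then a else b) * v (n - 1) + c * v (n - 2))
    (m n r : ℕ) (hm : 1 < m) :
    v (m * n + r) =
      a ^ (1 - (m * n + r) % 2) / (a * b) ^ ((m * n + r) / 2) *
        ∑ i ∈ Finset.range (n + 1),
          (n.choose i : ℝ) * c ^ (n - i) * u m ^ i * u (m - 1) ^ (n - i) * v (i + r) *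
            ((a * b) ^ ((i + r) / 2 + n * (m / 2)) *
              a ^ (-(((m + 1) % 2 : ℕ) : ℤ) * (i : ℤ) - 1 + (((i + r) % 2 : ℕ) : ℤ)) *
              b ^ (m % 2 * (n - i))) := by
  have hp : a * b ≠ 0 := mul_ne_zero ha hb
  obtain ⟨l, rfl⟩ : ∃ l, m = l + 1 := ⟨m - 1, by omega⟩
  have hadd := aux_add (a * b) (a * b * c) a
    (fun k => a ^ (k % 2) * (a * b) ^ (k / 2) * u k)
    (fun k => a ^ (k % 2) * (a * b) ^ (k / 2) * v k)
    (by simp [hu0]) (by simp [hu1]) (aux_scale a b c u hu) (aux_scale a b c v hv) l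
  have hbin := aux_binom
    (a ^ ((l + 1) % 2) * (a * b) ^ ((l + 1) / 2) * u (l + 1) / a)
    ((a * b * c) * (a ^ (l % 2) * (a * b) ^ (l / 2) * u l) / a)
    (fun k => a ^ (k % 2) * (a * b) ^ (k / 2) * v k) (l + 1)
    (fun k => by
      have := hadd k
      beta_reduce at this ⊢
      field_simp
      linear_combination this) n r
  beta_reduce at hbin
  have hS : a * ∑ i ∈ Finset.range (n + 1),
          (n.choose i : ℝ) * c ^ (n - i) * u (l + 1) ^ i * u (l + 1 - 1) ^ (n - i) * v (i + r) *
            ((a * b) ^ ((i + r) / 2 + n * ((l + 1) / 2)) *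
              a ^ (-(((l + 1 + 1) % 2 : ℕ) : ℤ) * (i : ℤ) - 1 + (((i + r) % 2 : ℕ) : ℤ)) *
              b ^ ((l + 1) % 2 * (n - i))) =
      a ^ (((l + 1) * n + r) % 2) * (a * b) ^ (((l + 1) * n + r) / 2) * v ((l + 1) * n + r) := by
    rw [hbin, Finset.mul_sum]
    refine Finset.sum_congr rfl fun i hi => ?_
    have hi' : i ≤ n := by simpa [Nat.lt_succ_iff] using hi
    obtain ⟨d, rfl⟩ : ∃ d, n = i + d := ⟨n - i, by omega⟩
    have e0 : i + d - i = d := by omega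
    have e1 : l + 1 - 1 = l := by omega
    rw [e0, e1, zpow_add₀ ha, zpow_sub₀ ha, zpow_natCast, zpow_one]
    generalize (i + r) % 2 = x
    generalize (i + r) / 2 = y
    rcases Nat.even_or_odd' l with ⟨j, rfl | rfl⟩
    · have t1 : (2 * j + 1 + 1) % 2 = 0 := by omega
      have t3 : (2 * j + 1) % 2 = 1 := by omega
      have t4 : (2 * j + 1) / 2 = j := by omega
      have t5 : (2 * j) % 2 = 0 := by omega
      have t6 : (2 * j) / 2 = j := by omega
      rw [t1, t3, t4, t5, t6]
      have f1 : a ^ 1 * (a * b) ^ j * u (2 * j + 1) / a = (a * b) ^ j * u (2 * j + 1) := by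
        field_simp
      have f2 : a * b * c * (a ^ 0 * (a * b) ^ j * u (2 * j)) / a
          = b * c * (a * b) ^ j * u (2 * j) := by
        field_simp
      rw [f1, f2]
      generalize a * b = p
      simp only [Nat.cast_zero, neg_zero, zero_mul, zpow_zero, one_mul]
      field_simp
      ring
    · have t1 : (2 * j + 1 + 1 + 1) % 2 = 1 := by omega
      have t3 : (2 * j + 1 + 1) % 2 = 0 := by omega
      have t4 : (2 * j + 1 + 1) / 2 = j + 1 := by omega
      have t5 : (2 * j + 1) % 2 = 1 := by omega
      have t6 : (2 * j + 1) / 2 = j := by omega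
      rw [t1, t3, t4, t5, t6]
      have f1 : a ^ 0 * (a * b) ^ (j + 1) * u (2 * j + 1 + 1) / a
          = (a * b) ^ (j + 1) * u (2 * j + 1 + 1) * a⁻¹ := by
        field_simp
      have f2 : a * b * c * (a ^ 1 * (a * b) ^ j * u (2 * j + 1)) / a
          = c * (a * b) ^ (j + 1) * u (2 * j + 1) := by
        field_simp
        ring
      have f3 : a ^ (-((1 : ℕ) : ℤ) * (i : ℤ)) = a⁻¹ ^ i := by
        rw [Nat.cast_one, neg_one_mul, zpow_neg, zpow_natCast, inv_pow]
      rw [f1, f2, f3]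
      generalize a * b = p
      simp only [mul_pow]
      generalize a⁻¹ ^ i = w at *
      field_simp
      ring
  have hN : a ^ (1 - ((l + 1) * n + r) % 2) * a ^ (((l + 1) * n + r) % 2) = a := by
    rw [← pow_add]
    have : 1 - ((l + 1) * n + r) % 2 + ((l + 1) * n + r) % 2 = 1 := by omega
    rw [this, pow_one]
  have hS' := (eq_div_iff ha).2 ((mul_comm _ _).trans hS)
  rw [hS']
  generalize ((l + 1) * n + r) / 2 = y at *
  generalize a ^ (1 - ((l + 1) * n + r) % 2) = s at *
  generalize a ^ (((l + 1) * n + r) % 2) = t at *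
  have hpy : (a * b) ^ y ≠ 0 := pow_ne_zero _ hp
  generalize (a * b) ^ y = z at *
  field_simp
  linear_combination (-v ((l + 1) * n + r)) * hN
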